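/- arXiv:1306.5139 — 4 statements merged into one kernel-verified Lean document; each statement's English description precedes it below -/
import Mathlib

section
/- Let f : X → Y be a mapping between real Banach spaces which is strictly differentiable at a point x₀ ∈ X. Then f is open at a linear rate around (x₀, f(x₀)) if and only if the strict (Fréchet) derivative Df(x₀) ∈ L(X,Y) is surjective. -/
open Set Metric

/-- A mapping `f : X → Y` is *open at a linear rate* around `(x₀, f x₀)` if there exist
positive `δ`, `ζ`, `σ` such that `f(B(x,r)) ⊇ B(f x, σ r) ∩ B(f x₀, ζ)` for every
`x ∈ B(x₀, δ)` and every `r ∈ [0, δ)`, balls being closed. -/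
def OpenAtLinearRate {X Y : Type*} [NormedAddCommGroup X] [NormedSpace ℝ X]
    [NormedAddCommGroup Y] [NormedSpace ℝ Y] (f : X → Y) (x₀ : X) : Prop :=
  ∃ δ > (0:ℝ), ∃ ζ > (0:ℝ), ∃ σ > (0:ℝ),
    ∀ x ∈ closedBall x₀ δ, ∀ r ∈ Set.Ico (0:ℝ) δ,
      closedBall (f x) (σ * r) ∩ closedBall (f x₀) ζ ⊆ f '' closedBall x r

open Filter Topology in
/-- A bounded linear map for which every point has an approximate preimage, with relative error
`1 / 2` and linearly controlled norm, is surjective. -/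
theorem ContinuousLinearMap.surjective_of_approx_preimage {X Y : Type*}
    [NormedAddCommGroup X] [NormedSpace ℝ X] [CompleteSpace X]
    [NormedAddCommGroup Y] [NormedSpace ℝ Y] (A : X →L[ℝ] Y) {C : ℝ} (hC : 0 ≤ C)
    (h : ∀ y, ∃ x, ‖y - A x‖ ≤ 1 / 2 * ‖y‖ ∧ ‖x‖ ≤ C * ‖y‖) :
    Function.Surjective A := by
  choose g hg hgC using h
  intro y
  let e : Y → Y := fun y => y - A (g y)
  have he (n : ℕ) : ‖e^[n] y‖ ≤ (1 / 2) ^ n * ‖y‖ := by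
    induction n with
    | zero => simp
    | succ n ih =>
      rw [Function.iterate_succ_apply', pow_succ', mul_assoc]
      exact (hg _).trans (by gcongr)
  have hu : Summable fun n => g (e^[n] y) := by
    refine .of_norm_bounded (g := fun n => (1 / 2 : ℝ) ^ n * (C * ‖y‖))
      (summable_geometric_two.mul_right _) fun n => ?_
    calc ‖g (e^[n] y)‖ ≤ C * ‖e^[n] y‖ := hgC _
      _ ≤ C * ((1 / 2) ^ n * ‖y‖) := by gcongr; exact he n
      _ = (1 / 2) ^ n * (C * ‖y‖) := by ring
  have hsum (n : ℕ) : A (∑ i ∈ Finset.range n, g (e^[i] y)) = y - e^[n] y := by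
    induction n with
    | zero => simp
    | succ n ih =>
      rw [Finset.sum_range_succ, map_add, ih, Function.iterate_succ_apply']
      simp only [e]
      abel
  have hlim : Tendsto (fun n => e^[n] y) atTop (𝓝 0) := by
    refine squeeze_zero_norm he ?_
    simpa using (tendsto_pow_atTop_nhds_zero_of_lt_one (r := (1 / 2 : ℝ))
      (by norm_num) (by norm_num)).mul_const ‖y‖
  refine ⟨∑' n, g (e^[n] y), tendsto_nhds_unique
    ((A.continuous.tendsto _).comp hu.hasSum.tendsto_sum_nat) ?_⟩
  simpa [Function.comp_def, hsum] using hlim.const_sub y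

theorem OpenAtLinearRate.surjective {X Y : Type*}
    [NormedAddCommGroup X] [NormedSpace ℝ X] [CompleteSpace X]
    [NormedAddCommGroup Y] [NormedSpace ℝ Y] {f : X → Y} {x₀ : X} {f' : X →L[ℝ] Y}
    (h : OpenAtLinearRate f x₀) (hf : HasFDerivAt f f' x₀) :
    Function.Surjective f' := by
  obtain ⟨δ, hδ, ζ, hζ, σ, hσ, h⟩ := h
  obtain ⟨η, hη, hfη⟩ := Metric.eventually_nhds_iff.1 (hf.isLittleO.def (half_pos hσ))
  obtain ⟨m, hm, hm'⟩ := exists_between (lt_min hζ (lt_min (mul_pos hσ hδ) (mul_pos hσ hη)))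
  obtain ⟨hmζ, hmδ, hmη⟩ : m < ζ ∧ m < σ * δ ∧ m < σ * η := by simpa only [lt_min_iff] using hm'
  refine f'.surjective_of_approx_preimage (inv_nonneg.2 hσ.le) fun y => ?_
  obtain ⟨t, ht, hty⟩ : ∃ t : ℝ, 0 < t ∧ t * ‖y‖ ≤ m := by
    refine ⟨m / (‖y‖ + 1), by positivity, ?_⟩
    rw [div_mul_eq_mul_div, div_le_iff₀ (by positivity)]
    nlinarith
  have hr {a : ℝ} (ha : m < σ * a) : σ⁻¹ * (t * ‖y‖) < a := by
    rw [inv_mul_lt_iff₀ hσ]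
    exact hty.trans_lt ha
  obtain ⟨x, hx, hfx⟩ := h x₀ (mem_closedBall_self hδ.le) (σ⁻¹ * (t * ‖y‖))
    ⟨by positivity, hr hmδ⟩ (show f x₀ + t • y ∈ _ by
      rw [mul_inv_cancel_left₀ hσ.ne']
      simp [norm_smul, abs_of_pos ht, hty.trans hmζ.le])
  rw [mem_closedBall, dist_eq_norm] at hx
  have hd := hfη (y := x) (by rw [dist_eq_norm]; exact hx.trans_lt (hr hmη))
  rw [hfx, add_sub_cancel_left] at hd
  refine ⟨t⁻¹ • (x - x₀), ?_, ?_⟩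
  · have key : y - f' (t⁻¹ • (x - x₀)) = t⁻¹ • (t • y - f' (x - x₀)) := by
      rw [map_smul, smul_sub t⁻¹ (t • y), inv_smul_smul₀ ht.ne']
    rw [key, norm_smul, norm_inv, Real.norm_of_nonneg ht.le, inv_mul_le_iff₀ ht]
    calc ‖t • y - f' (x - x₀)‖ ≤ σ / 2 * ‖x - x₀‖ := hd
      _ ≤ σ / 2 * (σ⁻¹ * (t * ‖y‖)) := by gcongr
      _ = t * (1 / 2 * ‖y‖) := by field_simp
  · rw [norm_smul, norm_inv, Real.norm_of_nonneg ht.le, inv_mul_le_iff₀ ht]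
    exact hx.trans_eq (by ring)

theorem HasStrictFDerivAt.openAtLinearRate {X Y : Type*}
    [NormedAddCommGroup X] [NormedSpace ℝ X] [CompleteSpace X]
    [NormedAddCommGroup Y] [NormedSpace ℝ Y] [CompleteSpace Y]
    {f : X → Y} {x₀ : X} {f' : X →L[ℝ] Y} (hf : HasStrictFDerivAt f f' x₀)
    (hsurj : Function.Surjective f') : OpenAtLinearRate f x₀ := by
  obtain ⟨g, hg⟩ := f'.exists_nonlinearRightInverse_of_surjective (LinearMap.range_eq_top.2 hsurj)
  have hc : 0 < g.nnnorm⁻¹ / 2 := by positivity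
  obtain ⟨s, hs, hfs⟩ := hf.approximates_deriv_on_nhds (Or.inr hc)
  obtain ⟨ε, hε, hεs⟩ := Metric.mem_nhds_iff.1 hs
  refine ⟨ε / 2, half_pos hε, 1, one_pos, (g.nnnorm : ℝ)⁻¹ / 2, by positivity, ?_⟩
  rintro x hx r ⟨hr₀, hr⟩ y ⟨hy, -⟩
  have hxs : closedBall x r ⊆ s :=
    (closedBall_subset_ball' (by rw [mem_closedBall] at hx; linarith)).trans hεs
  refine hfs.surjOn_closedBall_of_nonlinearRightInverse g hr₀ hxs ?_
  convert hy using 2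
  push_cast
  ring

/-- **Lyusternik–Graves theorem.** A mapping between real Banach spaces which is strictly
differentiable at `x₀` is open at a linear rate around `(x₀, f x₀)` if and only if its
strict (Fréchet) derivative at `x₀` is surjective. -/
theorem statement0 {X Y : Type*}
    [NormedAddCommGroup X] [NormedSpace ℝ X] [CompleteSpace X]
    [NormedAddCommGroup Y] [NormedSpace ℝ Y] [CompleteSpace Y]
    (f : X → Y) (x₀ : X) (f' : X →L[ℝ] Y) (hf : HasStrictFDerivAt f f' x₀) :
    OpenAtLinearRate f x₀ ↔ Function.Surjective (f' : X → Y) :=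
  ⟨fun h => h.surjective hf.hasFDerivAt, hf.openAtLinearRate⟩
end

section
/- Let f : X → Y be a mapping between real Banach spaces, Ω ⊆ X open, x₀ ∈ Ω, and r > 0 with B(x₀,r) ⊆ Ω. Suppose (i) X is uniformly convex with modulus of convexity δ_X satisfying the quadratic growth condition, and (ii) f ∈ C^{1,1}(Ω) and the Fréchet derivative Df(x₀) ∈ L(X,Y) is surjective. Then there exists ε₀ ∈ (0,r) such that the image f(B(x₀,ε)) is a convex set for every ε ∈ [0,ε₀]. -/
open Set Metric

/-- The modulus of convexity `δ_X : [0,2] → [0,1]` of a normed space `X`: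
`δ_X(ε) = inf {1 - ‖(x₁ + x₂)/2‖ : x₁, x₂ ∈ B(0,1), ‖x₁ - x₂‖ ≥ ε}`. -/
noncomputable def modCon (X : Type*) [NormedAddCommGroup X] [NormedSpace ℝ X] (ε : ℝ) : ℝ :=
  sInf {d : ℝ | ∃ x₁ x₂ : X, ‖x₁‖ ≤ 1 ∧ ‖x₂‖ ≤ 1 ∧ ε ≤ ‖x₁ - x₂‖ ∧
    d = 1 - ‖(1 / 2 : ℝ) • (x₁ + x₂)‖}

/-- `X` is uniformly convex (`δ_X(ε) > 0` for all `ε ∈ (0,2]`) with modulus of convexity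
satisfying the quadratic growth condition (`δ_X(ε) ≥ κ ε²` on `[0,2]` for some `κ > 0`). -/
def UnifConvexQuadGrowth (X : Type*) [NormedAddCommGroup X] [NormedSpace ℝ X] : Prop :=
  (∀ ε ∈ Set.Ioc (0:ℝ) 2, 0 < modCon X ε) ∧
    ∃ κ > (0:ℝ), ∀ ε ∈ Set.Icc (0:ℝ) 2, κ * ε ^ 2 ≤ modCon X ε

/-- `f` is of class `C^{1,1}` on the open set `Ω`, with derivative mapping `f'`:
`f` is Fréchet differentiable at each point of `Ω` and `x ↦ Df(x)` is Lipschitz on `Ω`. -/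
def C11On {X Y : Type*} [NormedAddCommGroup X] [NormedSpace ℝ X]
    [NormedAddCommGroup Y] [NormedSpace ℝ Y]
    (f : X → Y) (f' : X → X →L[ℝ] Y) (Ω : Set X) : Prop :=
  (∀ x ∈ Ω, HasFDerivAt f (f' x) x) ∧ ∃ L : NNReal, LipschitzOnWith L f' Ω

theorem modCon_le {X : Type*} [NormedAddCommGroup X] [NormedSpace ℝ X] {u v : X}
    (hu : ‖u‖ ≤ 1) (hv : ‖v‖ ≤ 1) : modCon X ‖u - v‖ ≤ 1 - ‖(1 / 2 : ℝ) • (u + v)‖ := by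
  refine csInf_le ⟨0, ?_⟩ ⟨u, v, hu, hv, le_rfl, rfl⟩
  rintro d ⟨x, y, hx, hy, -, rfl⟩
  have := norm_add_le x y
  rw [norm_smul, Real.norm_of_nonneg (by norm_num)]
  linarith

/-- Quadratic growth of the modulus of convexity, for a convex combination whose second weight
is at most `1 / 2`. -/
theorem norm_convexCombination_le_of_le_half {X : Type*} [NormedAddCommGroup X]
    [NormedSpace ℝ X] {κ : ℝ} (hκ : 0 ≤ κ)
    (h : ∀ ε ∈ Set.Icc (0 : ℝ) 2, κ * ε ^ 2 ≤ modCon X ε)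
    {u v : X} (hu : ‖u‖ ≤ 1) (hv : ‖v‖ ≤ 1) {t : ℝ} (ht : 0 ≤ t) (ht' : t ≤ 1 / 2) :
    ‖(1 - t) • u + t • v‖ ≤ 1 - 2 * κ * ((1 - t) * t * ‖u - v‖ ^ 2) := by
  have hd : ‖u - v‖ ≤ 2 := by linarith [norm_sub_le u v]
  have hm := (h _ ⟨norm_nonneg _, hd⟩).trans (modCon_le hu hv)
  have hx : (1 - t) • u + t • v = (1 - 2 * t) • u + (2 * t) • ((1 / 2 : ℝ) • (u + v)) := by
    module
  calc ‖(1 - t) • u + t • v‖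
      ≤ (1 - 2 * t) * ‖u‖ + 2 * t * ‖(1 / 2 : ℝ) • (u + v)‖ := by
        rw [hx]
        refine (norm_add_le _ _).trans_eq ?_
        rw [norm_smul, norm_smul (2 * t), Real.norm_of_nonneg (by linarith),
          Real.norm_of_nonneg (by linarith)]
    _ ≤ (1 - 2 * t) * 1 + 2 * t * (1 - κ * ‖u - v‖ ^ 2) := by
        gcongr <;> linarith
    _ ≤ 1 - 2 * κ * ((1 - t) * t * ‖u - v‖ ^ 2) := by
        have : 0 ≤ κ * ‖u - v‖ ^ 2 * t ^ 2 := by positivity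
        linarith

theorem norm_convexCombination_le {X : Type*} [NormedAddCommGroup X] [NormedSpace ℝ X]
    {κ : ℝ} (hκ : 0 ≤ κ) (h : ∀ ε ∈ Set.Icc (0 : ℝ) 2, κ * ε ^ 2 ≤ modCon X ε)
    {u v : X} (hu : ‖u‖ ≤ 1) (hv : ‖v‖ ≤ 1) {a b : ℝ} (ha : 0 ≤ a) (hb : 0 ≤ b)
    (hab : a + b = 1) :
    ‖a • u + b • v‖ ≤ 1 - 2 * κ * (a * b * ‖u - v‖ ^ 2) := by
  rcases le_total b (1 / 2) with hb' | hb'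
  · obtain rfl : a = 1 - b := by linarith
    exact norm_convexCombination_le_of_le_half hκ h hu hv hb hb'
  · obtain rfl : b = 1 - a := by linarith
    have := norm_convexCombination_le_of_le_half hκ h hv hu ha (by linarith)
    rwa [add_comm, norm_sub_rev, mul_comm a]

theorem norm_convexCombination_le_of_norm_le {X : Type*} [NormedAddCommGroup X]
    [NormedSpace ℝ X] {κ : ℝ} (hκ : 0 ≤ κ)
    (h : ∀ ε ∈ Set.Icc (0 : ℝ) 2, κ * ε ^ 2 ≤ modCon X ε)
    {u v : X} {ε : ℝ} (hε : 0 < ε) (hu : ‖u‖ ≤ ε) (hv : ‖v‖ ≤ ε) {a b : ℝ} (ha : 0 ≤ a)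
    (hb : 0 ≤ b) (hab : a + b = 1) :
    ‖a • u + b • v‖ ≤ ε - 2 * κ * (a * b * ‖u - v‖ ^ 2) / ε := by
  have key {w : X} : ‖ε⁻¹ • w‖ = ‖w‖ / ε := by
    rw [norm_smul, norm_inv, Real.norm_of_nonneg hε.le, inv_mul_eq_div]
  have := norm_convexCombination_le hκ h (u := ε⁻¹ • u) (v := ε⁻¹ • v)
    (by rw [key]; exact div_le_one_of_le₀ hu hε.le)
    (by rw [key]; exact div_le_one_of_le₀ hv hε.le) ha hb hab
  rw [smul_comm a, smul_comm b, ← smul_add, ← smul_sub, key, key, div_le_iff₀ hε] at this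
  refine this.trans_eq ?_
  field_simp

/-- First-order Taylor estimate for a function with Lipschitz derivative on a convex set. -/
theorem norm_image_sub_sub_le_of_lipschitzOnWith {X Y : Type*} [NormedAddCommGroup X]
    [NormedSpace ℝ X] [NormedAddCommGroup Y] [NormedSpace ℝ Y] {f : X → Y}
    {f' : X → X →L[ℝ] Y} {s : Set X} {L : NNReal} (hs : Convex ℝ s)
    (hf : ∀ x ∈ s, HasFDerivAt f (f' x) x) (hL : LipschitzOnWith L f' s) {x y : X}
    (hx : x ∈ s) (hy : y ∈ s) :
    ‖f y - f x - f' x (y - x)‖ ≤ L * ‖y - x‖ ^ 2 := by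
  have hsub : segment ℝ x y ⊆ s := hs.segment_subset hx hy
  refine ((convex_segment x y).norm_image_sub_le_of_norm_hasFDerivWithin_le'
    (C := L * ‖y - x‖) (fun z hz => (hf z (hsub hz)).hasFDerivWithinAt) (fun z hz => ?_)
    (left_mem_segment ℝ x y) (right_mem_segment ℝ x y)).trans_eq (by ring)
  refine (hL.norm_sub_le (hsub hz) hx).trans ?_
  gcongr
  obtain ⟨a, b, ha, hb, hab, rfl⟩ := hz
  have hz : a • x + b • y - x = b • (y - x) := by
    obtain rfl : a = 1 - b := by linarith
    module
  rw [hz, norm_smul, Real.norm_of_nonneg hb]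
  exact mul_le_of_le_one_left (norm_nonneg _) (by linarith)

/-- A function with Lipschitz derivative commutes with convex combinations up to a quadratic
error. -/
theorem norm_convexCombination_image_sub_le {X Y : Type*} [NormedAddCommGroup X]
    [NormedSpace ℝ X] [NormedAddCommGroup Y] [NormedSpace ℝ Y] {f : X → Y}
    {f' : X → X →L[ℝ] Y} {s : Set X} {L : NNReal} (hs : Convex ℝ s)
    (hf : ∀ x ∈ s, HasFDerivAt f (f' x) x) (hL : LipschitzOnWith L f' s) {u v : X}
    (hu : u ∈ s) (hv : v ∈ s) {a b : ℝ} (ha : 0 ≤ a) (hb : 0 ≤ b) (hab : a + b = 1) :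
    ‖a • f u + b • f v - f (a • u + b • v)‖ ≤ L * (a * b * ‖u - v‖ ^ 2) := by
  have hz : a • u + b • v ∈ s := hs hu hv ha hb hab
  have h₁ := norm_image_sub_sub_le_of_lipschitzOnWith hs hf hL hz hu
  have h₂ := norm_image_sub_sub_le_of_lipschitzOnWith hs hf hL hz hv
  set z := a • u + b • v with hzdef
  have hb' : b = 1 - a := by linarith
  have hu' : u - z = b • (u - v) := by rw [hzdef, hb']; module
  have hv' : v - z = (-a) • (u - v) := by rw [hzdef, hb']; module
  have hsum : a • f u + b • f v - f z =
      a • (f u - f z - f' z (u - z)) + b • (f v - f z - f' z (v - z)) := by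
    rw [hu', hv', map_smul, map_smul, hb']; module
  rw [hsum]
  refine (norm_add_le _ _).trans ?_
  rw [norm_smul, norm_smul, Real.norm_of_nonneg ha, Real.norm_of_nonneg hb]
  have e₁ : ‖u - z‖ = b * ‖u - v‖ := by rw [hu', norm_smul, Real.norm_of_nonneg hb]
  have e₂ : ‖v - z‖ = a * ‖u - v‖ := by
    rw [hv', norm_smul, norm_neg, Real.norm_of_nonneg ha]
  rw [e₁] at h₁
  rw [e₂] at h₂
  calc _ ≤ a * (L * (b * ‖u - v‖) ^ 2) + b * (L * (a * ‖u - v‖) ^ 2) := by gcongr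
    _ = L * (a * b * ‖u - v‖ ^ 2) := by rw [hb']; ring

theorem approximatesLinearOn_closedBall_of_lipschitzOnWith {X Y : Type*} [NormedAddCommGroup X]
    [NormedSpace ℝ X] [NormedAddCommGroup Y] [NormedSpace ℝ Y] {f : X → Y}
    {f' : X → X →L[ℝ] Y} {x₀ : X} {ρ L : NNReal}
    (hf : ∀ x ∈ closedBall x₀ ρ, HasFDerivAt f (f' x) x)
    (hL : LipschitzOnWith L f' (closedBall x₀ ρ)) :
    ApproximatesLinearOn f (f' x₀) (closedBall x₀ ρ) (L * ρ) := by
  intro x hx y hy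
  refine (convex_closedBall x₀ (ρ : ℝ)).norm_image_sub_le_of_norm_hasFDerivWithin_le'
    (fun z hz => (hf z hz).hasFDerivWithinAt) (fun z hz => ?_) hy hx
  refine (hL.norm_sub_le hz (mem_closedBall_self ρ.coe_nonneg)).trans ?_
  push_cast
  gcongr
  exact mem_closedBall_iff_norm.1 hz

/-- **Polyak's convexity principle.** Let `f : X → Y` be a mapping between real Banach
spaces, `Ω ⊆ X` open, `x₀ ∈ Ω`, `r > 0` with `B(x₀,r) ⊆ Ω`. If `X` is uniformly convex
with modulus of convexity satisfying the quadratic growth condition, `f ∈ C^{1,1}(Ω)` and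
`Df(x₀)` is surjective, then there is `ε₀ ∈ (0,r)` such that `f(B(x₀,ε))` is convex for
every `ε ∈ [0,ε₀]`. -/
theorem statement1 {X Y : Type*}
    [NormedAddCommGroup X] [NormedSpace ℝ X] [CompleteSpace X]
    [NormedAddCommGroup Y] [NormedSpace ℝ Y] [CompleteSpace Y]
    (Ω : Set X) (hΩ : IsOpen Ω) (x₀ : X) (hx₀ : x₀ ∈ Ω)
    (r : ℝ) (hr : 0 < r) (hball : closedBall x₀ r ⊆ Ω)
    (hX : UnifConvexQuadGrowth X)
    (f : X → Y) (f' : X → X →L[ℝ] Y) (hf : C11On f f' Ω)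
    (hsurj : Function.Surjective (f' x₀ : X → Y)) :
    ∃ ε₀ ∈ Set.Ioo (0:ℝ) r, ∀ ε ∈ Set.Icc (0:ℝ) ε₀,
      Convex ℝ (f '' closedBall x₀ ε) := by
  obtain ⟨-, κ, hκ, hκX⟩ := hX
  obtain ⟨hf, L, hL⟩ := hf
  obtain ⟨g, hg⟩ := (f' x₀).exists_nonlinearRightInverse_of_surjective
    (LinearMap.range_eq_top.2 hsurj)
  set σ : ℝ := (g.nnnorm : ℝ)⁻¹ with hσdef
  have hσ : 0 < σ := inv_pos.2 (NNReal.coe_pos.2 hg)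
  have hL1 : (0 : ℝ) < L + 1 := by positivity
  set ρ : ℝ := min (r / 2) (min (σ / 2) (κ * σ) / (L + 1)) with hρdef
  have hρ : 0 < ρ := by positivity
  have hρr : ρ < r := (min_le_left _ _).trans_lt (by linarith)
  have hLρ : L * ρ ≤ min (σ / 2) (κ * σ) := by
    have := (le_div_iff₀ hL1).1 (min_le_right (r / 2) (min (σ / 2) (κ * σ) / (L + 1)))
    rw [← hρdef] at this
    linarith
  have hLρ₁ : L * ρ ≤ σ / 2 := hLρ.trans (min_le_left _ _)
  have hLρ₂ : L * ρ ≤ κ * σ := hLρ.trans (min_le_right _ _)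
  have hρΩ : closedBall x₀ ρ ⊆ Ω := (closedBall_subset_closedBall hρr.le).trans hball
  have happ : ApproximatesLinearOn f (f' x₀) (closedBall x₀ ρ) (L * ⟨ρ, hρ.le⟩) :=
    approximatesLinearOn_closedBall_of_lipschitzOnWith (ρ := ⟨ρ, hρ.le⟩)
      (fun x hx => hf x (hρΩ hx)) (hL.mono hρΩ)
  refine ⟨ρ, ⟨hρ, hρr⟩, ?_⟩
  rintro ε ⟨hε₀, hερ⟩
  rcases hε₀.eq_or_lt with rfl | hε
  · simp
  have hερ' : closedBall x₀ ε ⊆ closedBall x₀ ρ := closedBall_subset_closedBall hερ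
  rintro _ ⟨u, hu, rfl⟩ _ ⟨v, hv, rfl⟩ a b ha hb hab
  have herr := norm_convexCombination_image_sub_le (convex_closedBall x₀ ρ)
    (fun x hx => hf x (hρΩ hx)) (hL.mono hρΩ) (hερ' hu) (hερ' hv) ha hb hab
  have hnorm := norm_convexCombination_le_of_norm_le hκ.le hκX hε
    (mem_closedBall_iff_norm.1 hu) (mem_closedBall_iff_norm.1 hv) ha hb hab
  have hcomb : a • (u - x₀) + b • (v - x₀) = a • u + b • v - x₀ := by
    obtain rfl : a = 1 - b := by linarith
    module
  rw [hcomb, sub_sub_sub_cancel_right] at hnorm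
  set z := a • u + b • v
  set q := a * b * ‖u - v‖ ^ 2
  have hq : 0 ≤ q := by positivity
  have hsub : closedBall z (2 * κ * q / ε) ⊆ closedBall x₀ ε :=
    closedBall_subset_closedBall' (by rw [dist_eq_norm]; linarith)
  refine image_mono hsub (happ.surjOn_closedBall_of_nonlinearRightInverse g (by positivity)
    (hsub.trans hερ') (mem_closedBall_iff_norm.2 (herr.trans ?_)))
  have hLε : L ≤ κ * σ / ε :=
    (le_div_iff₀ hε).2 ((mul_le_mul_of_nonneg_left hερ L.coe_nonneg).trans hLρ₂)
  calc L * q ≤ κ * σ / ε * q := by gcongr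
    _ = σ / 2 * (2 * κ * q / ε) := by ring
    _ ≤ (σ - L * ρ) * (2 * κ * q / ε) := by gcongr; linarith
end

section
/- For every real Banach space X of dimension greater than 1, the modulus of convexity admits the upper estimate δ_X(ε) ≤ 1 − √(1 − ε²/4) for all ε ∈ [0,2]. -/
open Set Metric

namespace Nordlander

/-- The area form on `ℂ`. -/
def wedge (z w : ℂ) : ℝ := z.re * w.im - z.im * w.re

/-- The radial function of the unit ball of `p`. -/
noncomputable def radius (p : Seminorm ℝ ℂ) (θ : ℝ) : ℝ := (p (Complex.exp (θ * Complex.I)))⁻¹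

/-- The point of the unit sphere of `p` with argument `θ`. -/
noncomputable def spherePoint (p : Seminorm ℝ ℂ) (θ : ℝ) : ℂ :=
  radius p θ • Complex.exp (θ * Complex.I)

/-- The area form evaluated at the points of the unit sphere with arguments `a` and `b`. -/
noncomputable def bracket (p : Seminorm ℝ ℂ) (a b : ℝ) : ℝ :=
  wedge (spherePoint p a) (spherePoint p b)

lemma wedge_smul_smul (s t : ℝ) (z w : ℂ) : wedge (s • z) (t • w) = s * t * wedge z w := by
  simp only [wedge, Complex.real_smul, Complex.re_ofReal_mul, Complex.im_ofReal_mul]; ring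

lemma wedge_smul_add_smul (a b c : ℂ) : wedge b c • a + wedge a b • c = wedge a c • b := by
  apply Complex.ext <;> simp [wedge] <;> ring

lemma seminorm_exp_pos {p : Seminorm ℝ ℂ} (hp : ∀ z, p z = 0 → z = 0) (θ : ℝ) :
    0 < p (Complex.exp (θ * Complex.I)) :=
  lt_of_le_of_ne (apply_nonneg p _) fun h => Complex.exp_ne_zero _ (hp _ h.symm)

lemma radius_pos {p : Seminorm ℝ ℂ} (hp : ∀ z, p z = 0 → z = 0) (θ : ℝ) : 0 < radius p θ :=
  inv_pos.2 (seminorm_exp_pos hp θ)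

lemma seminorm_smul_of_nonneg (p : Seminorm ℝ ℂ) {t : ℝ} (ht : 0 ≤ t) (z : ℂ) :
    p (t • z) = t * p z := by
  rw [map_smul_eq_mul, Real.norm_of_nonneg ht]

lemma seminorm_spherePoint {p : Seminorm ℝ ℂ} (hp : ∀ z, p z = 0 → z = 0) (θ : ℝ) :
    p (spherePoint p θ) = 1 := by
  rw [spherePoint, seminorm_smul_of_nonneg p (radius_pos hp θ).le, radius,
    inv_mul_cancel₀ (seminorm_exp_pos hp θ).ne']

lemma exp_add_pi (θ : ℝ) :
    Complex.exp ((θ + Real.pi : ℝ) * Complex.I) = -Complex.exp (θ * Complex.I) := by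
  rw [Complex.ofReal_add, add_mul, Complex.exp_add, Complex.exp_pi_mul_I]; ring

lemma radius_add_pi (p : Seminorm ℝ ℂ) (θ : ℝ) : radius p (θ + Real.pi) = radius p θ := by
  rw [radius, exp_add_pi, map_neg_eq_map, radius]

lemma spherePoint_add_pi (p : Seminorm ℝ ℂ) (θ : ℝ) :
    spherePoint p (θ + Real.pi) = -spherePoint p θ := by
  rw [spherePoint, radius_add_pi, exp_add_pi, smul_neg, spherePoint]

lemma continuous_radius {p : Seminorm ℝ ℂ} (hp : ∀ z, p z = 0 → z = 0) (hc : Continuous p) :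
    Continuous (radius p) :=
  Continuous.inv₀ (by fun_prop) fun θ => (seminorm_exp_pos hp θ).ne'

lemma continuous_spherePoint {p : Seminorm ℝ ℂ} (hp : ∀ z, p z = 0 → z = 0) (hc : Continuous p) :
    Continuous (spherePoint p) := by
  have := continuous_radius hp hc
  unfold spherePoint
  fun_prop

lemma bracket_eq (p : Seminorm ℝ ℂ) (a b : ℝ) :
    bracket p a b = radius p a * radius p b * Real.sin (b - a) := by
  rw [bracket, spherePoint, spherePoint, wedge_smul_smul, wedge]
  simp only [Complex.exp_ofReal_mul_I_re, Complex.exp_ofReal_mul_I_im]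
  rw [Real.sin_sub]; ring

lemma bracket_nonneg {p : Seminorm ℝ ℂ} (hp : ∀ z, p z = 0 → z = 0) {a b : ℝ} (hab : a ≤ b)
    (hba : b ≤ a + Real.pi) : 0 ≤ bracket p a b := by
  rw [bracket_eq]
  exact mul_nonneg (mul_nonneg (radius_pos hp a).le (radius_pos hp b).le)
    (Real.sin_nonneg_of_nonneg_of_le_pi (by linarith) (by linarith))

lemma triangle_of_smul_add_smul {p : Seminorm ℝ ℂ} {x y z : ℂ} (hx : p x = 1) (hy : p y = 1)
    (hz : p z = 1) {P Q R : ℝ} (hP : 0 ≤ P) (hQ : 0 ≤ Q) (hR : 0 ≤ R)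
    (h : P • x + Q • z = R • y) : R ≤ P + Q ∧ P ≤ Q + R ∧ Q ≤ P + R := by
  have h1 := map_add_le_add p (P • x) (Q • z)
  have h2 := map_sub_le_add p (R • y) (Q • z)
  have h3 := map_sub_le_add p (R • y) (P • x)
  rw [h] at h1
  rw [← h, add_sub_cancel_right] at h2
  rw [← h, add_sub_cancel_left] at h3
  rw [h] at h2 h3
  simp only [seminorm_smul_of_nonneg p hP, seminorm_smul_of_nonneg p hQ,
    seminorm_smul_of_nonneg p hR, hx, hy, hz, mul_one] at h1 h2 h3
  exact ⟨h1, by linarith, by linarith⟩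

lemma bracket_triangle {p : Seminorm ℝ ℂ} (hp : ∀ z, p z = 0 → z = 0) {a b c : ℝ} (hab : a ≤ b)
    (hbc : b ≤ c) (hca : c ≤ a + Real.pi) :
    bracket p a c ≤ bracket p b c + bracket p a b ∧
      bracket p b c ≤ bracket p a b + bracket p a c ∧
      bracket p a b ≤ bracket p b c + bracket p a c :=
  triangle_of_smul_add_smul (seminorm_spherePoint hp a) (seminorm_spherePoint hp b)
    (seminorm_spherePoint hp c) (bracket_nonneg hp hbc (by linarith))
    (bracket_nonneg hp hab (by linarith)) (bracket_nonneg hp (by linarith) hca)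
    (wedge_smul_add_smul _ _ _)

/-- In a quadrilateral with vertices `0, x, y, z`, the sum of two opposite sides is at most the
sum of the diagonals. -/
lemma seminorm_sub_le_of_smul_add_smul {p : Seminorm ℝ ℂ} {x y z : ℂ} (hx : p x = 1)
    (hy : p y = 1) (hz : p z = 1) {P Q R : ℝ} (hP : 0 ≤ P) (hQ : 0 ≤ Q) (hR : 0 < R)
    (h : P • x + Q • z = R • y) : p (x - y) ≤ p (x - z) := by
  have hRle := (triangle_of_smul_add_smul hx hy hz hP hQ hR.le h).1
  have hS : 0 < P + Q := by linarith
  have e1 : (P + Q) • (x - y) = Q • (x - z) - (P + Q - R) • y := by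
    rw [sub_smul, ← h]; module
  have e2 : (P + Q) • z = R • y - P • (x - z) := by
    rw [← h]; module
  have h1 := map_sub_le_add p (Q • (x - z)) ((P + Q - R) • y)
  have h2 := map_sub_le_add p (R • y) (P • (x - z))
  rw [← e1] at h1
  rw [← e2] at h2
  have hd : 0 ≤ P + Q - R := by linarith
  simp only [seminorm_smul_of_nonneg p hS.le, seminorm_smul_of_nonneg p hP,
    seminorm_smul_of_nonneg p hQ, seminorm_smul_of_nonneg p hR.le, seminorm_smul_of_nonneg p hd,
    hy, hz, mul_one] at h1 h2
  exact le_of_mul_le_mul_left (by linarith) hS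

lemma seminorm_sub_le_two {p : Seminorm ℝ ℂ} {x y : ℂ} (hx : p x = 1) (hy : p y = 1) :
    p (x - y) ≤ 2 := by
  linarith [map_sub_le_add p x y]

lemma chord_add_pi {p : Seminorm ℝ ℂ} (hp : ∀ z, p z = 0 → z = 0) (a : ℝ) :
    p (spherePoint p a - spherePoint p (a + Real.pi)) = 2 := by
  rw [spherePoint_add_pi, sub_neg_eq_add, ← two_smul ℝ,
    seminorm_smul_of_nonneg p (by norm_num), seminorm_spherePoint hp, mul_one]

lemma chord_mono_right {p : Seminorm ℝ ℂ} (hp : ∀ z, p z = 0 → z = 0) {a b c : ℝ} (hab : a ≤ b)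
    (hbc : b ≤ c) (hca : c ≤ a + Real.pi) :
    p (spherePoint p a - spherePoint p b) ≤ p (spherePoint p a - spherePoint p c) := by
  rcases eq_or_lt_of_le (hab.trans hbc) with rfl | hac
  · rw [le_antisymm hab hbc]
  rcases eq_or_lt_of_le hca with rfl | hca'
  · rw [chord_add_pi hp]
    exact seminorm_sub_le_two (seminorm_spherePoint hp _) (seminorm_spherePoint hp _)
  refine seminorm_sub_le_of_smul_add_smul (seminorm_spherePoint hp a) (seminorm_spherePoint hp b)
    (seminorm_spherePoint hp c) (bracket_nonneg hp hbc (by linarith))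
    (bracket_nonneg hp hab (by linarith)) (?_ : 0 < bracket p a c) (wedge_smul_add_smul _ _ _)
  rw [bracket_eq]
  exact mul_pos (mul_pos (radius_pos hp a) (radius_pos hp c))
    (Real.sin_pos_of_pos_of_lt_pi (by linarith) (by linarith))

lemma chord_anti_left {p : Seminorm ℝ ℂ} (hp : ∀ z, p z = 0 → z = 0) {a b c : ℝ} (hab : a ≤ b)
    (hbc : b ≤ c) (hca : c ≤ a + Real.pi) :
    p (spherePoint p b - spherePoint p c) ≤ p (spherePoint p a - spherePoint p c) := by
  rcases eq_or_lt_of_le (hab.trans hbc) with rfl | hac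
  · rw [le_antisymm hab hbc]
  rcases eq_or_lt_of_le hca with rfl | hca'
  · rw [chord_add_pi hp]
    exact seminorm_sub_le_two (seminorm_spherePoint hp _) (seminorm_spherePoint hp _)
  rw [map_sub_rev p (spherePoint p b), map_sub_rev p (spherePoint p a)]
  refine seminorm_sub_le_of_smul_add_smul (seminorm_spherePoint hp c) (seminorm_spherePoint hp b)
    (seminorm_spherePoint hp a) (bracket_nonneg hp hab (by linarith))
    (bracket_nonneg hp hbc (by linarith)) (?_ : 0 < bracket p a c)
    ((add_comm _ _).trans (wedge_smul_add_smul _ _ _))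
  rw [bracket_eq]
  exact mul_pos (mul_pos (radius_pos hp a) (radius_pos hp c))
    (Real.sin_pos_of_pos_of_lt_pi (by linarith) (by linarith))

lemma chord_le_chord {p : Seminorm ℝ ℂ} (hp : ∀ z, p z = 0 → z = 0) {a b c d : ℝ} (hab : a ≤ b)
    (hbc : b ≤ c) (hcd : c ≤ d) (hda : d ≤ a + Real.pi) :
    p (spherePoint p b - spherePoint p c) ≤ p (spherePoint p a - spherePoint p d) :=
  (chord_anti_left hp hab hbc (by linarith)).trans
    (chord_mono_right hp (hab.trans hbc) hcd hda)

/-- The chords of length `ε`, parametrized by the sum of the arguments of their endpoints. -/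
lemma exists_chord_parametrization {p : Seminorm ℝ ℂ} (hp : ∀ z, p z = 0 → z = 0)
    (hc : Continuous p) {ε : ℝ} (hε : 0 < ε) (hε2 : ε < 2) :
    ∃ α β : ℝ → ℝ, Monotone α ∧ Monotone β ∧ Continuous α ∧ Continuous β ∧
      (∀ s, α s + β s = s) ∧ (∀ s, α s < β s) ∧ (∀ s, β s < α s + Real.pi) ∧
      (∀ s, α (s + 2 * Real.pi) = α s + Real.pi) ∧ (∀ s, β (s + 2 * Real.pi) = β s + Real.pi) ∧
      ∀ s, p (spherePoint p (α s) - spherePoint p (β s)) = ε := by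
  have hpi := Real.pi_pos
  set G : ℝ → ℝ → ℝ := fun a b => p (spherePoint p a - spherePoint p b) with hG
  have hGc : ∀ s, Continuous fun t => G ((s - t) / 2) ((s + t) / 2) := fun s => by
    have := continuous_spherePoint hp hc
    fun_prop
  set A : ℝ → Set ℝ := fun s => {t | t ∈ Set.Icc 0 Real.pi ∧ ε ≤ G ((s - t) / 2) ((s + t) / 2)}
    with hA
  have hGpi : ∀ s, G ((s - Real.pi) / 2) ((s + Real.pi) / 2) = 2 := fun s => by
    have := chord_add_pi hp ((s - Real.pi) / 2)
    rwa [show (s - Real.pi) / 2 + Real.pi = (s + Real.pi) / 2 by ring] at this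
  have hG0 : ∀ s, G ((s - 0) / 2) ((s + 0) / 2) = 0 := fun s => by simp [hG]
  set D : ℝ → ℝ := fun s => sInf (A s) with hD
  have hAne : ∀ s, (A s).Nonempty := fun s => ⟨Real.pi, ⟨hpi.le, le_rfl⟩, by
    rw [hGpi]; exact hε2.le⟩
  have hAbdd : ∀ s, BddBelow (A s) := fun s => ⟨0, fun t ht => ht.1.1⟩
  have hAcl : ∀ s, IsClosed (A s) := fun s =>
    isClosed_Icc.inter (isClosed_le continuous_const (hGc s))
  have hDmem : ∀ s, D s ∈ A s := fun s => (hAcl s).csInf_mem (hAne s) (hAbdd s)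
  have hDle : ∀ s t, t ∈ A s → D s ≤ t := fun s t ht => csInf_le (hAbdd s) ht
  have hGD : ∀ s, G ((s - D s) / 2) ((s + D s) / 2) = ε := by
    intro s
    refine le_antisymm ?_ (hDmem s).2
    obtain ⟨t, ht, hte⟩ := intermediate_value_Icc hpi.le (hGc s).continuousOn
      (show ε ∈ Set.Icc _ _ from ⟨by rw [hG0]; exact hε.le, by rw [hGpi]; exact hε2.le⟩)
    have hle := hDle s t ⟨ht, hte.ge⟩
    rw [← hte]
    have := (hDmem s).1.1
    exact chord_le_chord hp (by linarith) (by linarith) (by linarith) (by linarith [ht.2])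
  have hDpos : ∀ s, 0 < D s := fun s => lt_of_le_of_ne (hDmem s).1.1 fun h => by
    have := hGD s
    rw [← h, hG0] at this
    exact hε.ne this
  have hDpi : ∀ s, D s < Real.pi := fun s => lt_of_le_of_ne (hDmem s).1.2 fun h => by
    have := hGD s
    rw [h, hGpi] at this
    exact hε2.ne' this
  have hstrict : ∀ s s', ¬ ((s' - D s') / 2 < (s - D s) / 2 ∧ (s + D s) / 2 < (s' + D s') / 2) := by
    rintro s s' ⟨h1, h2⟩
    have := hDpos s
    set t := max (s' - (s - D s)) (s + D s - s') with ht
    have hts : t < D s' := max_lt (by linarith) (by linarith)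
    have ht1 : s' - (s - D s) ≤ t := le_max_left _ _
    have ht2 : s + D s - s' ≤ t := le_max_right _ _
    refine absurd (hDle s' t ⟨⟨by linarith, by linarith [hDpi s']⟩, ?_⟩) (not_le.2 hts)
    rw [← hGD s]
    exact chord_le_chord hp (by linarith) (by linarith) (by linarith) (by linarith [hDpi s'])
  have hDper : ∀ s, D (s + 2 * Real.pi) = D s := by
    intro s
    have : A (s + 2 * Real.pi) = A s := by
      ext t
      simp only [hA, hG, Set.mem_ofPred_eq]
      rw [show (s + 2 * Real.pi - t) / 2 = (s - t) / 2 + Real.pi by ring,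
        show (s + 2 * Real.pi + t) / 2 = (s + t) / 2 + Real.pi by ring, spherePoint_add_pi,
        spherePoint_add_pi, neg_sub_neg, map_sub_rev p]
    simp only [hD, this]
  have hm1 : Monotone fun s => (s - D s) / 2 := by
    intro s s' hss
    by_contra! h
    exact hstrict s s' ⟨h, by linarith⟩
  have hm2 : Monotone fun s => (s + D s) / 2 := by
    intro s s' hss
    by_contra! h
    exact hstrict s' s ⟨by linarith, h⟩
  have hDc : Continuous D := by
    refine (LipschitzWith.of_le_add fun s s' => ?_).continuous
    rw [Real.dist_eq]
    rcases le_total s s' with h | h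
    · have := hm2 h
      simp only at this
      rw [abs_of_nonpos (by linarith)]
      linarith
    · have := hm1 h
      simp only at this
      rw [abs_of_nonneg (by linarith)]
      linarith
  exact ⟨fun s => (s - D s) / 2, fun s => (s + D s) / 2, hm1, hm2, by fun_prop, by fun_prop,
    fun s => by ring, fun s => by linarith [hDpos s], fun s => by linarith [hDpi s],
    fun s => by simp only [hDper]; ring, fun s => by simp only [hDper]; ring, hGD⟩

lemma eq_seminorm_smul_spherePoint {p : Seminorm ℝ ℂ} (hp : ∀ z, p z = 0 → z = 0) {z : ℂ} {θ : ℝ}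
    (h : z = ‖z‖ • Complex.exp (θ * Complex.I)) : z = p z • spherePoint p θ := by
  have h1 : p z = ‖z‖ * p (Complex.exp (θ * Complex.I)) := by
    conv_lhs => rw [h]
    exact seminorm_smul_of_nonneg p (norm_nonneg z) _
  rw [spherePoint, smul_smul, radius, h1, mul_inv_cancel_right₀ (seminorm_exp_pos hp θ).ne']
  exact h

/-- A continuous choice of arguments for a curve that stays in a rotating open half-plane. -/
lemma exists_continuous_arg {p : Seminorm ℝ ℂ} (hp : ∀ z, p z = 0 → z = 0) {z : ℝ → ℂ}
    (hz : Continuous z) (c : ℝ)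
    (hre : ∀ s : ℝ, 0 < (z s * Complex.exp ((-(s / 2 + c) : ℝ) * Complex.I)).re)
    (hper : ∀ s, z (s + 2 * Real.pi) = -z s) :
    ∃ ψ : ℝ → ℝ, Continuous ψ ∧ (∀ s, ψ (s + 2 * Real.pi) = ψ s + Real.pi) ∧
      ∀ s, z s = p (z s) • spherePoint p (ψ s) := by
  set w : ℝ → ℂ := fun s => z s * Complex.exp ((-(s / 2 + c) : ℝ) * Complex.I) with hw
  have hwc : Continuous w := by fun_prop
  have hwper : ∀ s, w (s + 2 * Real.pi) = w s := fun s => by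
    have h : Complex.exp ((-(s / 2 + c) : ℝ) * Complex.I) =
        -Complex.exp ((-((s + 2 * Real.pi) / 2 + c) : ℝ) * Complex.I) := by
      rw [← exp_add_pi]
      congr 3
      ring
    simp only [hw, hper, h]
    ring
  refine ⟨fun s => s / 2 + c + (w s).arg, ?_, fun s => ?_, fun s => ?_⟩
  · have : Continuous fun s => (w s).arg := continuous_iff_continuousAt.2 fun s =>
      (Complex.continuousAt_arg (show w s ∈ Complex.slitPlane from Or.inl (hre s))).comp
        hwc.continuousAt
    fun_prop
  · simp only [hwper]
    ring
  · apply eq_seminorm_smul_spherePoint hp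
    have hnorm : ‖w s‖ = ‖z s‖ := by
      rw [hw, norm_mul, Complex.norm_exp_ofReal_mul_I, mul_one]
    have h1 := Complex.norm_mul_exp_arg_mul_I (w s)
    rw [hnorm] at h1
    rw [Complex.real_smul, Complex.ofReal_add, add_mul, Complex.exp_add, mul_left_comm, h1, hw]
    simp only
    rw [mul_left_comm, ← Complex.exp_add, Complex.ofReal_neg, neg_mul, add_neg_cancel,
      Complex.exp_zero, mul_one]

/-- Twice the area of the sector of the unit ball of `p` between the arguments `0` and `θ`. -/
noncomputable def sector (p : Seminorm ℝ ℂ) (θ : ℝ) : ℝ := ∫ t in (0 : ℝ)..θ, radius p t ^ 2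

lemma hasDerivAt_sector {p : Seminorm ℝ ℂ} (hp : ∀ z, p z = 0 → z = 0) (hc : Continuous p)
    (θ : ℝ) : HasDerivAt (sector p) (radius p θ ^ 2) θ :=
  (((continuous_radius hp hc).pow 2).integral_hasStrictDerivAt 0 θ).hasDerivAt

lemma exists_sector_add_pi {p : Seminorm ℝ ℂ} (hp : ∀ z, p z = 0 → z = 0) (hc : Continuous p) :
    ∃ C, 0 < C ∧ ∀ θ, sector p (θ + Real.pi) = sector p θ + C := by
  have hcr : Continuous fun t => radius p t ^ 2 := (continuous_radius hp hc).pow 2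
  refine ⟨∫ t in (0 : ℝ)..Real.pi, radius p t ^ 2, ?_, fun θ => ?_⟩
  · exact intervalIntegral.intervalIntegral_pos_of_pos (hcr.intervalIntegrable _ _)
      (fun t => pow_pos (radius_pos hp t) 2) Real.pi_pos
  · have hper : Function.Periodic (fun t => radius p t ^ 2) Real.pi := fun t => by
      simp only [radius_add_pi]
    have h := hper.intervalIntegral_add_eq θ 0
    rw [zero_add] at h
    rw [← h, sector, sector, intervalIntegral.integral_add_adjacent_intervals
      (hcr.intervalIntegrable _ _) (hcr.intervalIntegrable _ _)]

lemma hasDerivAt_bracket {p : Seminorm ℝ ℂ} (hp : ∀ z, p z = 0 → z = 0) (hc : Continuous p)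
    (θ : ℝ) : HasDerivAt (bracket p θ) (radius p θ ^ 2) θ := by
  have hs : HasDerivAt (fun t => Real.sin (t - θ)) 1 θ := by
    simpa using ((hasDerivAt_id θ).sub_const θ).sin
  rw [hasDerivAt_iff_tendsto_slope] at hs ⊢
  have hr : Filter.Tendsto (fun t => radius p θ * radius p t) (nhdsWithin θ {θ}ᶜ)
      (nhds (radius p θ * radius p θ)) :=
    ((continuous_const.mul (continuous_radius hp hc)).tendsto θ).mono_left nhdsWithin_le_nhds
  have h := hr.mul hs
  rw [mul_one, ← sq] at h
  refine h.congr fun t => ?_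
  simp only [slope_def_field, bracket_eq, sub_self, Real.sin_zero, mul_zero, sub_zero]
  ring

/-- To first order, triangles and sectors have the same area. -/
lemma eventually_bracket_sub_sector_le {p : Seminorm ℝ ℂ} (hp : ∀ z, p z = 0 → z = 0)
    (hc : Continuous p) {φ : ℝ → ℝ} (hφ : Continuous φ) (s : ℝ) {η : ℝ} (hη : 0 < η) :
    ∀ᶠ t in nhds s, |bracket p (φ s) (φ t) - (sector p (φ t) - sector p (φ s))| ≤
      η * |φ t - φ s| := by
  have h := ((hasDerivAt_bracket hp hc (φ s)).sub (hasDerivAt_sector hp hc (φ s))).isLittleO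
  have h2 := hφ.continuousAt.eventually (h.bound hη)
  filter_upwards [h2] with t ht
  have h0 : bracket p (φ s) (φ s) = 0 := by simp [bracket_eq]
  simp only [Pi.sub_apply, h0, sub_self, smul_zero, sub_zero, Real.norm_eq_abs] at ht
  convert ht using 2
  ring

lemma le_of_wedge_nonneg {p : Seminorm ℝ ℂ} (hp : ∀ z, p z = 0 → z = 0) {z w : ℂ} {a b : ℝ}
    (hz : z = p z • spherePoint p a) (hw : w = p w • spherePoint p b) (hz0 : 0 < p z)
    (hw0 : 0 < p w) (hab : |b - a| < Real.pi) (h : 0 ≤ wedge z w) : a ≤ b := by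
  by_contra! hlt
  rw [hz, hw, wedge_smul_smul, ← bracket, bracket_eq] at h
  have := abs_lt.1 hab
  have hsin : Real.sin (b - a) < 0 := Real.sin_neg_of_neg_of_neg_pi_lt (by linarith) this.1
  have := mul_pos (mul_pos hz0 hw0) (mul_pos (radius_pos hp a) (radius_pos hp b))
  nlinarith [mul_neg_of_pos_of_neg this hsin]

lemma wedge_add_add_wedge_sub_sub (x y x' y' : ℂ) :
    wedge (x + y) (x' + y') + wedge (x - y) (x' - y') = 2 * wedge x x' + 2 * wedge y y' := by
  simp only [wedge, Complex.add_re, Complex.add_im, Complex.sub_re, Complex.sub_im]; ring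

lemma wedge_chords_nonneg {p : Seminorm ℝ ℂ} (hp : ∀ z, p z = 0 → z = 0) {a a' b b' : ℝ}
    (h1 : a ≤ a') (h2 : a' ≤ b) (h3 : b ≤ b') (h4 : b' ≤ a + Real.pi) :
    0 ≤ wedge (spherePoint p a + spherePoint p b) (spherePoint p a' + spherePoint p b') ∧
      0 ≤ wedge (spherePoint p a - spherePoint p b) (spherePoint p a' - spherePoint p b') := by
  have t1 := bracket_triangle hp h1 h2 (by linarith)
  have t2 := bracket_triangle hp (h1.trans h2) h3 h4
  have t3 := bracket_triangle hp h1 (h2.trans h3) h4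
  have t4 := bracket_triangle hp h2 h3 (by linarith)
  simp only [bracket, wedge, Complex.add_re, Complex.add_im, Complex.sub_re,
    Complex.sub_im] at t1 t2 t3 t4 ⊢
  constructor <;> linarith

lemma le_of_eventually_le_right {f : ℝ → ℝ} (hf : Continuous f)
    (h : ∀ s, ∀ᶠ t in nhdsWithin s (Set.Ioi s), f t ≤ f s) {a b : ℝ} (hab : a ≤ b) :
    f b ≤ f a := by
  refine image_le_of_liminf_slope_right_le_deriv_boundary (B := fun _ => f a) (B' := fun _ => 0)
    hf.continuousOn le_rfl continuousOn_const (fun x _ => hasDerivWithinAt_const _ _ _)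
    (fun x _ r hr => ?_) (Set.right_mem_Icc.2 hab)
  refine Filter.Eventually.frequently ?_
  filter_upwards [h x, self_mem_nhdsWithin] with t ht hxt
  refine lt_of_le_of_lt ?_ hr
  rw [slope_def_field]
  exact div_nonpos_of_nonpos_of_nonneg (by linarith) (by linarith [Set.mem_Ioi.1 hxt])

/-- If the midpoints of all chords of length `ε` of the unit ball of `p` have norm at most `M`,
then comparing the areas enclosed by the unit sphere and by the midpoints bounds `M` below. -/
lemma one_le_of_midpoint_le {p : Seminorm ℝ ℂ} (hp : ∀ z, p z = 0 → z = 0)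
    (hc : Continuous p) {ε M : ℝ} (hε : 0 < ε) (hε2 : ε < 2)
    (hM : ∀ x y, p x = 1 → p y = 1 → p (x - y) = ε → p (x + y) ≤ 2 * M) :
    1 ≤ M ^ 2 + ε ^ 2 / 4 := by
  obtain ⟨α, β, hαm, hβm, hαc, hβc, hsum, hαβ, hβα, hαper, hβper, hchord⟩ :=
    exists_chord_parametrization hp hc hε hε2
  have hSc := continuous_spherePoint hp hc
  have hpi := Real.pi_pos
  set x : ℝ → ℂ := fun s => spherePoint p (α s) with hx
  set y : ℝ → ℂ := fun s => spherePoint p (β s) with hy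
  have hxper : ∀ s, x (s + 2 * Real.pi) = -x s := fun s => by
    simp only [hx, hαper, spherePoint_add_pi]
  have hyper : ∀ s, y (s + 2 * Real.pi) = -y s := fun s => by
    simp only [hy, hβper, spherePoint_add_pi]
  have hrot : ∀ a c, spherePoint p a * Complex.exp ((c : ℝ) * Complex.I) =
      radius p a • Complex.exp ((a + c : ℝ) * Complex.I) := fun a c => by
    rw [spherePoint, smul_mul_assoc, ← Complex.exp_add, Complex.ofReal_add, add_mul]
  have hre : ∀ r a : ℝ, (r • Complex.exp (a * Complex.I)).re = r * Real.cos a := fun r a => by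
    rw [Complex.smul_re, Complex.exp_ofReal_mul_I_re, smul_eq_mul]
  have hadd : ∀ s : ℝ, 0 < ((x s + y s) * Complex.exp ((-(s / 2 + 0) : ℝ) * Complex.I)).re := by
    intro s
    rw [add_mul, Complex.add_re, hrot, hrot, hre, hre]
    have h1 := hsum s
    have h2 := hαβ s
    have h3 := hβα s
    exact add_pos (mul_pos (radius_pos hp _) (Real.cos_pos_of_mem_Ioo ⟨by linarith, by linarith⟩))
      (mul_pos (radius_pos hp _) (Real.cos_pos_of_mem_Ioo ⟨by linarith, by linarith⟩))
  have hsub : ∀ s : ℝ, 0 < ((x s - y s) *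
      Complex.exp ((-(s / 2 + -(Real.pi / 2)) : ℝ) * Complex.I)).re := by
    intro s
    rw [sub_mul, Complex.sub_re, hrot, hrot, hre, hre]
    have h1 := hsum s
    have h2 := hαβ s
    have h3 := hβα s
    exact sub_pos.2 (lt_trans (mul_neg_of_pos_of_neg (radius_pos hp _)
      (Real.cos_neg_of_pi_div_two_lt_of_lt (by linarith) (by linarith)))
      (mul_pos (radius_pos hp _) (Real.cos_pos_of_mem_Ioo ⟨by linarith, by linarith⟩)))
  obtain ⟨ψ, hψc, hψper, hψ⟩ := exists_continuous_arg hp (z := fun s => x s + y s)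
    (by fun_prop) 0 hadd fun s => by rw [hxper, hyper, neg_add]
  obtain ⟨κ, hκc, hκper, hκ⟩ := exists_continuous_arg hp (z := fun s => x s - y s)
    (by fun_prop) (-(Real.pi / 2)) hsub fun s => by rw [hxper, hyper]; ring
  have hlen : ∀ s, p (x s - y s) = ε := hchord
  have hmid : ∀ s, p (x s + y s) ≤ 2 * M := fun s =>
    hM _ _ (seminorm_spherePoint hp _) (seminorm_spherePoint hp _) (hchord s)
  have hmid0 : ∀ s, 0 < p (x s + y s) := fun s => lt_of_le_of_ne (apply_nonneg p _) fun h => by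
    have := hadd s
    rw [hp _ h.symm, zero_mul] at this
    exact lt_irrefl _ this
  obtain ⟨C, hC, hCF⟩ := exists_sector_add_pi hp hc
  have hFc : Continuous (sector p) :=
    continuous_iff_continuousAt.2 fun θ => (hasDerivAt_sector hp hc θ).continuousAt
  have key : ∀ η : ℝ, 0 < η →
      C * (2 - 2 * M ^ 2 - ε ^ 2 / 2) ≤ η * (Real.pi * (2 + 2 * M ^ 2 + ε ^ 2 / 2)) := by
    intro η hη
    set f : ℝ → ℝ := fun s => (sector p (α s) - η * α s) + (sector p (β s) - η * β s)
      - 2 * M ^ 2 * (sector p (ψ s) + η * ψ s) - ε ^ 2 / 2 * (sector p (κ s) + η * κ s) with hf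
    have hmono : f (0 + 2 * Real.pi) ≤ f 0 := by
      refine le_of_eventually_le_right (by fun_prop) (fun s => ?_) (by linarith)
      have e1 : ∀ᶠ t in nhds s, α t < β s := hαc.continuousAt.eventually_lt_const (hαβ s)
      have e2 : ∀ᶠ t in nhds s, β t < α s + Real.pi :=
        hβc.continuousAt.eventually_lt_const (hβα s)
      have e3 : ∀ᶠ t in nhds s, |ψ t - ψ s| < Real.pi :=
        (by fun_prop : Continuous fun t => |ψ t - ψ s|).continuousAt.eventually_lt_const
          (by simpa using hpi)
      have e4 : ∀ᶠ t in nhds s, |κ t - κ s| < Real.pi :=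
        (by fun_prop : Continuous fun t => |κ t - κ s|).continuousAt.eventually_lt_const
          (by simpa using hpi)
      have d1 := eventually_bracket_sub_sector_le hp hc hαc s hη
      have d2 := eventually_bracket_sub_sector_le hp hc hβc s hη
      have d3 := eventually_bracket_sub_sector_le hp hc hψc s hη
      have d4 := eventually_bracket_sub_sector_le hp hc hκc s hη
      filter_upwards [self_mem_nhdsWithin, nhdsWithin_le_nhds (e1.and (e2.and (e3.and e4))),
        nhdsWithin_le_nhds (d1.and (d2.and (d3.and d4)))] with t hst ⟨e1, e2, e3, e4⟩
        ⟨d1, d2, d3, d4⟩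
      have hst' : s ≤ t := (Set.mem_Ioi.1 hst).le
      have hα := hαm hst'
      have hβ := hβm hst'
      obtain ⟨w1, w2⟩ := wedge_chords_nonneg hp hα e1.le hβ e2.le
      have hψm : ψ s ≤ ψ t := le_of_wedge_nonneg hp (hψ s) (hψ t) (hmid0 s) (hmid0 t) e3 w1
      have hκm : κ s ≤ κ t := le_of_wedge_nonneg hp (hκ s) (hκ t) (by rw [hlen]; exact hε)
        (by rw [hlen]; exact hε) e4 w2
      have hid := wedge_add_add_wedge_sub_sub (x s) (y s) (x t) (y t)
      have hw1 : wedge (x s + y s) (x t + y t) ≤ 4 * M ^ 2 * bracket p (ψ s) (ψ t) := by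
        have hb : 0 ≤ bracket p (ψ s) (ψ t) :=
          bracket_nonneg hp hψm (by linarith [(abs_lt.1 e3).2])
        rw [hψ s, hψ t, wedge_smul_smul, ← bracket]
        have := mul_le_mul (hmid s) (hmid t) (hmid0 t).le ((hmid0 s).le.trans (hmid s))
        nlinarith [mul_le_mul_of_nonneg_right this hb]
      have hw2 : wedge (x s - y s) (x t - y t) = ε ^ 2 * bracket p (κ s) (κ t) := by
        rw [hκ s, hκ t, wedge_smul_smul, ← bracket, hlen, hlen, sq]
      rw [abs_of_nonneg (sub_nonneg.2 hα)] at d1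
      rw [abs_of_nonneg (sub_nonneg.2 hβ)] at d2
      rw [abs_of_nonneg (sub_nonneg.2 hψm)] at d3
      rw [abs_of_nonneg (sub_nonneg.2 hκm)] at d4
      have d1' := (abs_le.1 d1).1
      have d2' := (abs_le.1 d2).1
      have d3' := mul_le_mul_of_nonneg_left (abs_le.1 d3).2 (by positivity : 0 ≤ 2 * M ^ 2)
      have d4' := mul_le_mul_of_nonneg_left (abs_le.1 d4).2 (by positivity : 0 ≤ ε ^ 2 / 2)
      have hid' : 2 * bracket p (α s) (α t) + 2 * bracket p (β s) (β t) ≤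
          4 * M ^ 2 * bracket p (ψ s) (ψ t) + ε ^ 2 * bracket p (κ s) (κ t) := by
        rw [bracket, bracket]
        linarith
      simp only [hf]
      linarith
    simp only [hf, hαper, hβper, hψper, hκper, hCF] at hmono
    linarith
  have hfin : C * (2 - 2 * M ^ 2 - ε ^ 2 / 2) ≤ 0 := by
    refine le_of_forall_pos_le_add fun δ hδ => ?_
    have hK : 0 < Real.pi * (2 + 2 * M ^ 2 + ε ^ 2 / 2) := by positivity
    have := key _ (div_pos hδ hK)
    rwa [div_mul_cancel₀ _ hK.ne', ← zero_add δ] at this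
  have := nonpos_of_mul_nonpos_right hfin hC
  linarith

lemma modCon_le {X : Type*} [NormedAddCommGroup X] [NormedSpace ℝ X] {ε : ℝ} {x y : X}
    (hx : ‖x‖ ≤ 1) (hy : ‖y‖ ≤ 1) (hxy : ε ≤ ‖x - y‖) : modCon X ε ≤ 1 - ‖x + y‖ / 2 := by
  refine csInf_le ⟨0, ?_⟩ ⟨x, y, hx, hy, hxy, ?_⟩
  · rintro d ⟨a, b, ha, hb, -, rfl⟩
    rw [norm_smul, Real.norm_of_nonneg (by norm_num)]
    linarith [norm_add_le a b]
  · rw [norm_smul, Real.norm_of_nonneg (by norm_num)]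
    ring

/-- A space of dimension greater than one contains a real plane, which carries the restricted
norm. -/
lemma exists_injective_complex {X : Type*} [AddCommGroup X] [Module ℝ X]
    (hdim : 1 < Module.rank ℝ X) : ∃ L : ℂ →ₗ[ℝ] X, ∀ z, L z = 0 → z = 0 := by
  have : Nontrivial X := (rank_pos_iff_nontrivial (R := ℝ)).1 (zero_lt_one.trans hdim)
  obtain ⟨u, hu⟩ := exists_ne (0 : X)
  obtain ⟨v, huv⟩ := exists_linearIndependent_pair_of_one_lt_rank hdim hu
  refine ⟨Complex.reLm.smulRight u + Complex.imLm.smulRight v, fun z hz => ?_⟩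
  have h := LinearIndependent.pair_iff.1 huv z.re z.im (by simpa using hz)
  exact Complex.ext h.1 h.2

end Nordlander

/-- **Nordlander's estimate.** For every real Banach space `X` of dimension greater than
one, the modulus of convexity satisfies `δ_X(ε) ≤ 1 - √(1 - ε²/4)` for all `ε ∈ [0,2]`. -/
theorem statement4 {X : Type*} [NormedAddCommGroup X] [NormedSpace ℝ X] [CompleteSpace X]
    (hdim : 1 < Module.rank ℝ X) :
    ∀ ε ∈ Set.Icc (0:ℝ) 2, modCon X ε ≤ 1 - Real.sqrt (1 - ε ^ 2 / 4) := by
  rintro ε ⟨hε, hε2⟩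
  have : Nontrivial X := (rank_pos_iff_nontrivial (R := ℝ)).1 (zero_lt_one.trans hdim)
  obtain ⟨v, hv⟩ := exists_norm_eq X zero_le_one
  have hle_one : modCon X ε ≤ 1 := by
    have h := Nordlander.modCon_le (ε := ε) (x := v) (y := -v) hv.le (by rw [norm_neg, hv])
      (by rw [sub_neg_eq_add, ← two_smul ℝ, norm_smul, hv]; simpa using hε2)
    simpa using h
  rcases hε.eq_or_lt with rfl | hε0
  · have h := Nordlander.modCon_le (ε := 0) hv.le hv.le (norm_nonneg (v - v))
    rw [← two_smul ℝ, norm_smul, hv] at h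
    norm_num at h ⊢
    exact h
  rcases hε2.eq_or_lt with rfl | hε2'
  · norm_num
    exact hle_one
  by_contra! hlt
  obtain ⟨L, hL⟩ := Nordlander.exists_injective_complex hdim
  have h := Nordlander.one_le_of_midpoint_le (p := (normSeminorm ℝ X).comp L) (ε := ε)
    (M := 1 - modCon X ε) (fun z hz => hL z (norm_eq_zero.1 hz))
    (L.continuous_of_finiteDimensional.norm) hε0 hε2' fun x y hx hy hxy => by
      simp only [Seminorm.comp_apply, coe_normSeminorm, map_sub, map_add] at hx hy hxy ⊢
      linarith [Nordlander.modCon_le hx.le hy.le hxy.ge]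
  have hM := (Real.lt_sqrt (by linarith)).1 (by linarith : 1 - modCon X ε < √(1 - ε ^ 2 / 4))
  linarith
end

section
/- With reference to the vector optimization problem (VOP) with C ⊆ Y nonempty, closed and convex, let x₀ ∈ X, ε > 0, and z ∈ B(x₀,ε) with g(z) ∈ C. If there exists (w*, y*) ∈ (W* × Y*) \ {(0,0)} such that w* ∈ K⊕ with ker w* = {0}, −y* ∈ N(C; g(z)), and L(w*, y*; z) ≥ L(w*, y*; x) for all x ∈ B(x₀,ε), then z is a (global) solution to the ε-localization (VOP_{x₀,ε}). -/
open Set Metric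

/-- **Sufficient optimality condition for localized vector optimization problems.**
Consider (VOP): K-maximize `h x` subject to `g x ∈ C`, with `K ⊆ W` a closed, convex,
pointed cone with apex at `0` and `C ⊆ Y` nonempty, closed and convex. Let `x₀ ∈ X`,
`ε > 0` and `z ∈ B(x₀,ε)` with `g z ∈ C`. If there exists
`(w*, y*) ∈ (W* × Y*) \ {(0,0)}` such that `w* ∈ K⊕` with `ker w* = {0}`,
`-y* ∈ N(C; g z)`, and `L(w*, y*; z) ≥ L(w*, y*; x)` for all `x ∈ B(x₀,ε)` (where
`L(w*, y*; x) = ⟨w*, h x⟩ + ⟨y*, g x⟩`), then `z` is a global solution to the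
ε-localization (VOP_{x₀,ε}). -/
theorem statement9 {X W Y : Type*}
    [NormedAddCommGroup X] [NormedSpace ℝ X] [CompleteSpace X]
    [NormedAddCommGroup W] [NormedSpace ℝ W] [CompleteSpace W]
    [NormedAddCommGroup Y] [NormedSpace ℝ Y] [CompleteSpace Y]
    (h : X → W) (g : X → Y)
    (C : Set Y) (hCne : C.Nonempty) (hCcl : IsClosed C) (hCconv : Convex ℝ C)
    (K : Set W) (hKcl : IsClosed K) (hKconv : Convex ℝ K)
    (hKcone : ∀ c : ℝ, 0 ≤ c → ∀ w ∈ K, c • w ∈ K)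
    (hK0 : (0:W) ∈ K) (hKpointed : K ∩ (-K) = {0})
    (x₀ : X) (ε : ℝ) (hε : 0 < ε)
    (z : X) (hzball : z ∈ closedBall x₀ ε) (hzC : g z ∈ C)
    (ws : W →L[ℝ] ℝ) (ys : Y →L[ℝ] ℝ) (hne : (ws, ys) ≠ (0, 0))
    (hws : ∀ w ∈ K, 0 ≤ ws w) (hker : ∀ w : W, ws w = 0 → w = 0)
    (hys : ∀ y ∈ C, (-ys) (y - g z) ≤ 0)
    (hlagr : ∀ x ∈ closedBall x₀ ε, ws (h x) + ys (g x) ≤ ws (h z) + ys (g z)) :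
    h '' ({x | g x ∈ C} ∩ closedBall x₀ ε) ∩ {w | w - h z ∈ K} = {h z} := by
  refine Subset.antisymm ?_ (singleton_subset_iff.2 ⟨mem_image_of_mem h ⟨hzC, hzball⟩, ?_⟩)
  · rintro _ ⟨⟨x, ⟨hxC, hxball⟩, rfl⟩, hxK⟩
    have hnonneg := hws _ hxK
    have hnormal := hys _ hxC
    have hlagr_x := hlagr x hxball
    rw [neg_apply] at hnormal
    rw [map_sub] at hnonneg hnormal
    exact sub_eq_zero.1 (hker _ (by rw [map_sub]; linarith))
  · simpa using hK0
end
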